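/- Suppose 𝒜 has rank 2, the linear order on 𝒜 is admissible (there exists an integer ν such that H_i and H_1 are parallel, i.e. H_i ∩ H_1 = ∅ or i = 1, if and only if 1 ≤ i < ν), and λ(X) ≠ 0 for every dense X ∈ L ∖ {V}. Then the set of residue classes {[ω_B] : B ∈ βnbc(𝒜)} is a ℂ-basis of A^2 / (ω_λ ∧ A^1). -/

import Mathlib

open Module

noncomputable section

/-- An arrangement of `n` (affine) hyperplanes inside the ambient affine subspace `amb`
of the complex vector space `W`.  The linear order on the hyperplanes is the order of the
indices in `Fin n`; an arbitrary linear order is encoded by a permutation `σ` of `Fin n`,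
with `i ≺ j ↔ σ i < σ j`. -/
structure HArr (W : Type) [AddCommGroup W] [Module ℂ W] (n : ℕ) where
  amb : AffineSubspace ℂ W
  amb_ne : (amb : Set W).Nonempty
  H : Fin n → AffineSubspace ℂ W
  inj : Function.Injective H
  le_amb : ∀ i, H i ≤ amb
  nonemptyH : ∀ i, ((H i : Set W)).Nonempty
  hyp : ∀ i, finrank ℂ (H i).direction + 1 = finrank ℂ amb.direction

namespace HArr

variable {W : Type} [AddCommGroup W] [Module ℂ W] {n : ℕ}

/-- The intersection `⋂ S` of a subset of the arrangement (the ambient space for `S = ∅`). -/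
def inter (A : HArr W n) (S : Finset (Fin n)) : AffineSubspace ℂ W :=
  A.amb ⊓ S.inf A.H

/-- Codimension (inside the ambient space) of an affine subspace. -/
def cd (A : HArr W n) (X : AffineSubspace ℂ W) : ℕ :=
  finrank ℂ A.amb.direction - finrank ℂ X.direction

/-- A dependent subset of the arrangement. -/
def dep (A : HArr W n) (S : Finset (Fin n)) : Prop :=
  A.inter S ≠ ⊥ ∧ A.cd (A.inter S) < S.card

/-- An independent subset of the arrangement. -/
def indep (A : HArr W n) (S : Finset (Fin n)) : Prop :=
  A.inter S ≠ ⊥ ∧ A.cd (A.inter S) = S.card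

/-- A base: a maximal independent subset. -/
def isBase (A : HArr W n) (S : Finset (Fin n)) : Prop :=
  A.indep S ∧ ∀ T, A.indep T → S ⊆ T → S = T

open scoped Classical in
/-- The rank of a subarrangement `{H i : i ∈ C}`. -/
def rankOn (A : HArr W n) (C : Finset (Fin n)) : ℕ :=
  C.powerset.sup fun S => if A.indep S then S.card else 0

/-- The rank `r` of the arrangement. -/
def rank (A : HArr W n) : ℕ := A.rankOn Finset.univ

/-- A circuit: an inclusion-minimal dependent set. -/
def circuit (A : HArr W n) (S : Finset (Fin n)) : Prop :=
  A.dep S ∧ ∀ T ⊂ S, ¬ A.dep T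

/-- A broken circuit w.r.t. the linear order given by `σ`. -/
def brokenCircuit (A : HArr W n) (σ : Equiv.Perm (Fin n)) (S : Finset (Fin n)) : Prop :=
  ∃ i ∉ S, (∀ j ∈ S, σ i < σ j) ∧ A.circuit (insert i S)

/-- An nbc set: nonempty intersection and containing no broken circuit. -/
def nbcSet (A : HArr W n) (σ : Equiv.Perm (Fin n)) (S : Finset (Fin n)) : Prop :=
  A.inter S ≠ ⊥ ∧ ∀ T ⊆ S, ¬ A.brokenCircuit σ T

/-- An nbc-base. -/
def nbcBase (A : HArr W n) (σ : Equiv.Perm (Fin n)) (S : Finset (Fin n)) : Prop :=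
  A.nbcSet σ S ∧ A.isBase S

/-- A βnbc-base. -/
def betaNbcBase (A : HArr W n) (σ : Equiv.Perm (Fin n)) (S : Finset (Fin n)) : Prop :=
  A.nbcBase σ S ∧ ∀ i ∈ S, ∃ j, σ j < σ i ∧ A.isBase (insert j (S.erase i))

/-- Membership in the intersection poset `L(𝒜)`. -/
def memL (A : HArr W n) (X : AffineSubspace ℂ W) : Prop :=
  X ≠ ⊥ ∧ ∃ S : Finset (Fin n), A.inter S = X

/-- A maximal element of `L(𝒜)` (in the reverse-inclusion order). -/
def maximalL (A : HArr W n) (X : AffineSubspace ℂ W) : Prop :=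
  A.memL X ∧ ∀ Y, A.memL Y → Y ≤ X → Y = X

open scoped Classical in
/-- The set of indices of hyperplanes containing `X`, i.e. `𝒜_X`. -/
def sub (A : HArr W n) (X : AffineSubspace ℂ W) : Finset (Fin n) :=
  Finset.univ.filter fun i => X ≤ A.H i

/-- `X` is dense: `𝒜_X` admits no decomposition into two nonempty parts. -/
def denseL (A : HArr W n) (X : AffineSubspace ℂ W) : Prop :=
  ¬ ∃ S T : Finset (Fin n), Disjoint S T ∧ S.Nonempty ∧ T.Nonempty ∧
      S ∪ T = A.sub X ∧ A.cd (A.inter S) + A.cd (A.inter T) = A.cd X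

/-- `i` is the minimum of `S` w.r.t. the linear order given by `σ`. -/
def isMin (σ : Equiv.Perm (Fin n)) (i : Fin n) (S : Finset (Fin n)) : Prop :=
  i ∈ S ∧ ∀ j ∈ S, σ i ≤ σ j

/-- The standard ordered tuple of a finite set, w.r.t. the linear order given by `σ`:
`tup σ S p` is the element of `S` with `(p+1)`-st smallest `σ`-value. -/
def tup (σ : Equiv.Perm (Fin n)) (S : Finset (Fin n)) (p : Fin S.card) : Fin n :=
  σ.symm (((S.image ⇑σ).orderIsoOfFin (Finset.card_image_of_injective S σ.injective) p).1)

/-- The flag `ξ(B) = (X_1 > ⋯ > X_r)` of a standard ordered base: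
`flag σ S p = X_{p+1} = ⋂_{k ≥ p} H_{i_k}`. -/
def flag (A : HArr W n) (σ : Equiv.Perm (Fin n)) (S : Finset (Fin n)) (p : Fin S.card) :
    AffineSubspace ℂ W :=
  A.inter (S.filter fun i => σ (tup σ S p) ≤ σ i)

/-- Lexicographic order on standard ordered tuples (for the canonical order). -/
def lexLt (S T : Finset (Fin n)) : Prop :=
  List.Lex (· < ·) (S.sort (· ≤ ·)) (T.sort (· ≤ ·))

/-- `λ(X) = Σ_{H_i ∈ 𝒜_X} λ_i`. -/
def lamX (A : HArr W n) (lam : Fin n → ℂ) (X : AffineSubspace ℂ W) : ℂ :=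
  ∑ i ∈ A.sub X, lam i

/-- `X` is unmixed (w.r.t. the order `σ`). -/
def unmixedX (A : HArr W n) (σ : Equiv.Perm (Fin n)) (X : AffineSubspace ℂ W) : Prop :=
  (∀ S, A.nbcBase σ S → A.inter S = X → A.betaNbcBase σ S) ∨
  (∀ S, A.nbcBase σ S → A.inter S = X → ¬ A.betaNbcBase σ S)

/-- The linear order given by `σ` is unmixed. -/
def unmixedOrd (A : HArr W n) (σ : Equiv.Perm (Fin n)) : Prop :=
  ∀ X, A.maximalL X → A.unmixedX σ X

/-- Membership in the intersection poset of the deleted arrangement `𝒜 ∖ {H_{i₀}}`. -/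
def memLdel (A : HArr W n) (i₀ : Fin n) (X : AffineSubspace ℂ W) : Prop :=
  X ≠ ⊥ ∧ ∃ S : Finset (Fin n), i₀ ∉ S ∧ A.inter S = X

/-- A maximal element of the intersection poset of the deleted arrangement. -/
def maximalLdel (A : HArr W n) (i₀ : Fin n) (X : AffineSubspace ℂ W) : Prop :=
  A.memLdel i₀ X ∧ ∀ Y, A.memLdel i₀ Y → Y ≤ X → Y = X

/-- The generator `e_i` of the exterior algebra `E`. -/
def gen (i : Fin n) : ExteriorAlgebra ℂ (Fin n → ℂ) :=
  ExteriorAlgebra.ι ℂ (Pi.single i 1)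

/-- `e_S = e_{i_1} ∧ ⋯ ∧ e_{i_p}` for `S = {i_1 < ⋯ < i_p}`. -/
def eS (S : Finset (Fin n)) : ExteriorAlgebra ℂ (Fin n → ℂ) :=
  ((S.sort (· ≤ ·)).map gen).prod

/-- `∂e_S = Σ_k (−1)^{k−1} e_{S ∖ {i_k}}`. -/
def bdry (S : Finset (Fin n)) : ExteriorAlgebra ℂ (Fin n → ℂ) :=
  ∑ i ∈ S, ((-1 : ℂ) ^ (S.filter fun j => j < i).card) • eS (S.erase i)

/-- The defining relations of the Orlik–Solomon algebra. -/
inductive OSRel (A : HArr W n) :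
    ExteriorAlgebra ℂ (Fin n → ℂ) → ExteriorAlgebra ℂ (Fin n → ℂ) → Prop
  | isBot : ∀ S : Finset (Fin n), A.inter S = ⊥ → OSRel A (eS S) 0
  | isDep : ∀ S : Finset (Fin n), A.dep S → OSRel A (bdry S) 0

/-- The Orlik–Solomon algebra `A(𝒜)`: the exterior algebra modulo the ideal generated by
the `e_S` with empty intersection and the `∂e_S` with `S` dependent. -/
abbrev OS (A : HArr W n) := RingQuot (OSRel A)

/-- The quotient map `E → A(𝒜)`. -/
def osMk (A : HArr W n) : ExteriorAlgebra ℂ (Fin n → ℂ) →ₐ[ℂ] OS A :=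
  RingQuot.mkAlgHom ℂ (OSRel A)

/-- `ω_i`, the image of `e_i` in the Orlik–Solomon algebra. -/
def om (A : HArr W n) (i : Fin n) : OS A := osMk A (gen i)

/-- `ω_B`, the image of `e_B` in the Orlik–Solomon algebra. -/
def omB (A : HArr W n) (S : Finset (Fin n)) : OS A := osMk A (eS S)

/-- The degree `p` part `A^p` of the Orlik–Solomon algebra. -/
def deg (A : HArr W n) (p : ℕ) : Submodule ℂ (OS A) :=
  Submodule.span ℂ {x | ∃ S : Finset (Fin n), S.card = p ∧ x = omB A S}

/-- `ω_λ = Σ_i λ_i ω_i`. -/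
def omLam (A : HArr W n) (lam : Fin n → ℂ) : OS A := ∑ i, lam i • om A i

/-- `ω_λ(X) = Σ_{H_i ∈ 𝒜_X} λ_i ω_i`. -/
def omLamX (A : HArr W n) (lam : Fin n → ℂ) (X : AffineSubspace ℂ W) : OS A :=
  ∑ i ∈ A.sub X, lam i • om A i

/-- The form `Ξ(B) = ω_λ(X_1) ⋯ ω_λ(X_r)` attached to a standard ordered base. -/
def Xi (A : HArr W n) (σ : Equiv.Perm (Fin n)) (lam : Fin n → ℂ) (S : Finset (Fin n)) :
    OS A :=
  ((List.finRange S.card).map fun p => A.omLamX lam (A.flag σ S p)).prod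

/-- The submodule `ω_λ ∧ A^p` of the Orlik-Solomon algebra. -/
def Ideg (A : HArr W n) (lam : Fin n → ℂ) (p : ℕ) : Submodule ℂ (OS A) :=
  (A.deg p).map (LinearMap.mulLeft ℂ (A.omLam lam))

end HArr

open scoped Classical

namespace HArr

variable {W : Type} [AddCommGroup W] [Module ℂ W] {n : ℕ}

section Geometry

theorem inter_empty (A : HArr W n) : A.inter ∅ = A.amb := by
  simp [inter]

theorem inter_singleton (A : HArr W n) (i : Fin n) : A.inter {i} = A.H i := by
  simpa [inter] using A.le_amb i

theorem inter_pair (A : HArr W n) (i j : Fin n) : A.inter {i, j} = A.H i ⊓ A.H j := by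
  simpa [inter] using inf_le_left.trans (A.le_amb i)

theorem inter_triple (A : HArr W n) (i j k : Fin n) :
    A.inter {i, j, k} = A.H i ⊓ A.H j ⊓ A.H k := by
  simpa [inter, inf_assoc] using inf_le_left.trans (A.le_amb i)

theorem inter_le_H (A : HArr W n) {S : Finset (Fin n)} {i : Fin n} (hi : i ∈ S) :
    A.inter S ≤ A.H i :=
  inf_le_right.trans (Finset.inf_le hi)

theorem amb_ne_bot (A : HArr W n) : A.amb ≠ ⊥ :=
  (AffineSubspace.nonempty_iff_ne_bot _).1 A.amb_ne

theorem H_ne_bot (A : HArr W n) (i : Fin n) : A.H i ≠ ⊥ :=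
  (AffineSubspace.nonempty_iff_ne_bot _).1 (A.nonemptyH i)

theorem cd_H (A : HArr W n) (i : Fin n) : A.cd (A.H i) = 1 := by
  have := A.hyp i
  unfold cd
  omega

theorem mem_sub (A : HArr W n) {X : AffineSubspace ℂ W} {k : Fin n} :
    k ∈ A.sub X ↔ X ≤ A.H k := by
  simp [sub]

theorem index_ne (A : HArr W n) {i j : Fin n}
    (h : (A.H i).direction ≠ (A.H j).direction) : i ≠ j :=
  fun h' => h (by rw [h'])

theorem two_le_card_of_inter_eq_bot (A : HArr W n) {S : Finset (Fin n)}
    (h : A.inter S = ⊥) : 2 ≤ S.card := by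
  by_contra! hc
  have h0 : S.card = 0 ∨ S.card = 1 := by omega
  rcases h0 with h0 | h0
  · rw [Finset.card_eq_zero.1 h0, inter_empty] at h
    exact A.amb_ne_bot h
  · obtain ⟨i, rfl⟩ := Finset.card_eq_one.1 h0
    rw [inter_singleton] at h
    exact A.H_ne_bot i h

variable [FiniteDimensional ℂ W]

theorem cd_anti (A : HArr W n) {X Y : AffineSubspace ℂ W} (h : X ≤ Y) :
    A.cd Y ≤ A.cd X := by
  have := Submodule.finrank_mono (AffineSubspace.direction_le h)
  unfold cd
  omega

theorem sup_direction_eq (A : HArr W n) {D : Submodule ℂ W} (hD : D ≤ A.amb.direction)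
    (k : Fin n) (h : ¬ D ≤ (A.H k).direction) : D ⊔ (A.H k).direction = A.amb.direction := by
  have hk := AffineSubspace.direction_le (A.le_amb k)
  have hlt : (A.H k).direction < D ⊔ (A.H k).direction :=
    lt_of_le_of_ne le_sup_right fun e => h (le_sup_left.trans e.ge)
  have h1 := Submodule.finrank_lt_finrank_of_lt hlt
  have h2 := A.hyp k
  exact Submodule.eq_of_le_of_finrank_le (sup_le hD hk) (by omega)

theorem finrank_inf_H (A : HArr W n) {X : AffineSubspace ℂ W} (hX : X ≤ A.amb) (k : Fin n)
    (hne : X ⊓ A.H k ≠ ⊥) (hle : ¬ X ≤ A.H k) :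
    finrank ℂ (X ⊓ A.H k).direction + 1 = finrank ℂ X.direction := by
  obtain ⟨p, hpX, hpk⟩ := (AffineSubspace.nonempty_iff_ne_bot _).2 hne
  have hdir : ¬ X.direction ≤ (A.H k).direction := fun h => hle fun x hx => by
    have := AffineSubspace.vadd_mem_of_mem_direction
      (h (AffineSubspace.vsub_mem_direction hx hpX)) hpk
    simpa using this
  have h1 := A.sup_direction_eq (AffineSubspace.direction_le hX) k hdir
  have h2 := Submodule.finrank_sup_add_finrank_inf_eq X.direction (A.H k).direction
  rw [h1, ← AffineSubspace.direction_inf_of_mem hpX hpk] at h2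
  have h3 := A.hyp k
  omega

theorem eq_of_H_le (A : HArr W n) {i j : Fin n} (h : A.H i ≤ A.H j) : i = j := by
  apply A.inj
  obtain ⟨p, hp⟩ := A.nonemptyH i
  refine AffineSubspace.eq_of_direction_eq_of_nonempty_of_le ?_ ⟨p, hp⟩ h
  refine Submodule.eq_of_le_of_finrank_eq (AffineSubspace.direction_le h) ?_
  have := A.hyp i
  have := A.hyp j
  omega

theorem direction_eq_iff (A : HArr W n) (i j : Fin n) :
    (A.H i).direction = (A.H j).direction ↔ A.H i ⊓ A.H j = ⊥ ∨ i = j := by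
  constructor
  · intro h
    by_contra! hc
    obtain ⟨p, hpi, hpj⟩ := (AffineSubspace.nonempty_iff_ne_bot _).2 hc.1
    exact hc.2 (A.inj (AffineSubspace.ext_of_direction_eq h ⟨p, hpi, hpj⟩))
  · rintro (h | rfl)
    · by_contra hd
      have hle : ¬ (A.H i).direction ≤ (A.H j).direction := fun hle =>
        hd (Submodule.eq_of_le_of_finrank_eq hle (by have := A.hyp i; have := A.hyp j; omega))
      have hsup := A.sup_direction_eq (AffineSubspace.direction_le (A.le_amb i)) j hle
      obtain ⟨p, hp⟩ := A.nonemptyH i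
      obtain ⟨q, hq⟩ := A.nonemptyH j
      have hpq : q -ᵥ p ∈ A.amb.direction :=
        AffineSubspace.vsub_mem_direction (A.le_amb j hq) (A.le_amb i hp)
      rw [← hsup] at hpq
      obtain ⟨u, hu, v, hv, huv⟩ := Submodule.mem_sup.1 hpq
      have h1 : u +ᵥ p ∈ A.H i := AffineSubspace.vadd_mem_of_mem_direction hu hp
      have h2 : -v +ᵥ q ∈ A.H j :=
        AffineSubspace.vadd_mem_of_mem_direction (neg_mem hv) hq
      have h3 : -v +ᵥ q = u +ᵥ p := by
        simp only [vsub_eq_sub, vadd_eq_add] at huv ⊢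
        rw [eq_add_of_sub_eq huv.symm]
        abel
      rw [h3] at h2
      have h4 : u +ᵥ p ∈ A.H i ⊓ A.H j := ⟨h1, h2⟩
      rw [h] at h4
      exact h4
    · rfl

theorem inf_ne_bot (A : HArr W n) {i j : Fin n}
    (h : (A.H i).direction ≠ (A.H j).direction) : A.H i ⊓ A.H j ≠ ⊥ :=
  fun h' => h ((A.direction_eq_iff i j).2 (.inl h'))

theorem direction_ne (A : HArr W n) {i j : Fin n} (h : A.H i ⊓ A.H j ≠ ⊥) (hij : i ≠ j) :
    (A.H i).direction ≠ (A.H j).direction :=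
  fun h' => ((A.direction_eq_iff i j).1 h').elim h hij

theorem finrank_pair (A : HArr W n) {i j : Fin n}
    (h : (A.H i).direction ≠ (A.H j).direction) :
    finrank ℂ (A.H i ⊓ A.H j).direction + 2 = finrank ℂ A.amb.direction := by
  have h1 := A.finrank_inf_H (A.le_amb i) j (A.inf_ne_bot h)
    fun hle => A.index_ne h (A.eq_of_H_le hle)
  have h2 := A.hyp i
  omega

theorem cd_pair (A : HArr W n) {i j : Fin n}
    (h : (A.H i).direction ≠ (A.H j).direction) : A.cd (A.H i ⊓ A.H j) = 2 := by
  have := A.finrank_pair h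
  unfold cd
  omega

theorem three_le_card_of_dep (A : HArr W n) {S : Finset (Fin n)} (h : A.dep S) :
    3 ≤ S.card := by
  by_contra! hc
  have h0 : S.card = 0 ∨ S.card = 1 ∨ S.card = 2 := by omega
  obtain ⟨h1, h2⟩ := h
  rcases h0 with h0 | h0 | h0
  · omega
  · obtain ⟨i, rfl⟩ := Finset.card_eq_one.1 h0
    rw [inter_singleton, cd_H, h0] at h2
    omega
  · obtain ⟨i, j, hij, rfl⟩ := Finset.card_eq_two.1 h0
    rw [inter_pair] at h1 h2
    rw [A.cd_pair (A.direction_ne h1 hij), h0] at h2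
    omega

theorem indep_pair (A : HArr W n) {i j : Fin n}
    (h : (A.H i).direction ≠ (A.H j).direction) : A.indep {i, j} := by
  rw [indep, inter_pair, A.cd_pair h, Finset.card_pair (A.index_ne h)]
  exact ⟨A.inf_ne_bot h, rfl⟩

end Geometry

section RankTwo

theorem card_le_rank (A : HArr W n) {S : Finset (Fin n)} (h : A.indep S) :
    S.card ≤ A.rank := by
  have := Finset.le_sup (f := fun S : Finset (Fin n) => (if A.indep S then S.card else 0 : ℕ))
    (Finset.mem_powerset.2 (Finset.subset_univ S))
  simp only [if_pos h] at this
  exact this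

variable [FiniteDimensional ℂ W]

theorem exists_direction_ne (A : HArr W n) (hr : A.rank = 2) :
    ∃ i j, (A.H i).direction ≠ (A.H j).direction := by
  by_contra! hc
  have : A.rank ≤ 1 := by
    rw [rank, rankOn]
    refine Finset.sup_le fun S _ => ?_
    split_ifs with h
    · by_contra! hS
      obtain ⟨i, hi, j, hj, hij⟩ := Finset.one_lt_card.1 hS
      refine A.direction_ne (fun hb => h.1 ?_) hij (hc i j)
      exact le_bot_iff.1 (hb ▸ le_inf (A.inter_le_H hi) (A.inter_le_H hj))
    · exact Nat.zero_le _
  omega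

theorem le_H_of_meet (A : HArr W n) (hr : A.rank = 2) {i j k : Fin n}
    (h : (A.H i).direction ≠ (A.H j).direction) (hk : A.H i ⊓ A.H j ⊓ A.H k ≠ ⊥) :
    A.H i ⊓ A.H j ≤ A.H k := by
  by_contra hle
  have hik : i ≠ k := by rintro rfl; exact hle inf_le_left
  have hjk : j ≠ k := by rintro rfl; exact hle inf_le_right
  have hc : ({i, j, k} : Finset (Fin n)).card = 3 :=
    Finset.card_eq_three.2 ⟨i, j, k, A.index_ne h, hik, hjk, rfl⟩
  have h1 := A.finrank_inf_H (inf_le_left.trans (A.le_amb i)) k hk hle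
  have h2 := A.finrank_pair h
  have hI : A.indep {i, j, k} := by
    refine ⟨by rwa [inter_triple], ?_⟩
    rw [inter_triple, hc, cd]
    omega
  have := A.card_le_rank hI
  omega

theorem inf_eq_of_mem_sub (A : HArr W n) (hr : A.rank = 2) {i j k l : Fin n}
    (h : (A.H i).direction ≠ (A.H j).direction) (hk : k ∈ A.sub (A.H i ⊓ A.H j))
    (hl : l ∈ A.sub (A.H i ⊓ A.H j)) (hkl : k ≠ l) :
    (A.H k).direction ≠ (A.H l).direction ∧ A.H k ⊓ A.H l = A.H i ⊓ A.H j := by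
  rw [mem_sub] at hk hl
  have hX : A.H i ⊓ A.H j ≤ A.H k ⊓ A.H l := le_inf hk hl
  have hd : (A.H k).direction ≠ (A.H l).direction :=
    A.direction_ne (fun hb => A.inf_ne_bot h (le_bot_iff.1 (hb ▸ hX))) hkl
  refine ⟨hd, le_antisymm (le_inf ?_ ?_) hX⟩
  · exact A.le_H_of_meet hr hd fun hb =>
      A.inf_ne_bot h (le_bot_iff.1 (hb ▸ le_inf hX inf_le_left))
  · exact A.le_H_of_meet hr hd fun hb =>
      A.inf_ne_bot h (le_bot_iff.1 (hb ▸ le_inf hX inf_le_right))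

theorem isBase_iff (A : HArr W n) (hr : A.rank = 2) {S : Finset (Fin n)} :
    A.isBase S ↔ ∃ i j, S = {i, j} ∧ (A.H i).direction ≠ (A.H j).direction := by
  constructor
  · rintro ⟨hS, hmax⟩
    have hle := A.card_le_rank hS
    obtain ⟨a, b, hab⟩ := A.exists_direction_ne hr
    have h0 : S.card = 0 ∨ S.card = 1 ∨ S.card = 2 := by omega
    rcases h0 with h0 | h0 | h0
    · have := hmax _ (A.indep_pair hab) (by simp [Finset.card_eq_zero.1 h0])
      exact ⟨a, b, this, hab⟩
    · obtain ⟨i, rfl⟩ := Finset.card_eq_one.1 h0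
      have : ∃ j, (A.H i).direction ≠ (A.H j).direction := by
        by_contra! hc
        exact hab ((hc a).symm.trans (hc b))
      obtain ⟨j, hj⟩ := this
      exact ⟨i, j, hmax _ (A.indep_pair hj) (by simp), hj⟩
    · obtain ⟨i, j, hij, rfl⟩ := Finset.card_eq_two.1 h0
      have := hS.1
      rw [inter_pair] at this
      exact ⟨i, j, rfl, A.direction_ne this hij⟩
  · rintro ⟨i, j, rfl, h⟩
    refine ⟨A.indep_pair h, fun T hT hs => Finset.eq_of_subset_of_card_le hs ?_⟩
    rw [Finset.card_pair (A.index_ne h), ← hr]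
    exact A.card_le_rank hT

theorem isBase_pair_iff (A : HArr W n) (hr : A.rank = 2) {i j : Fin n} :
    A.isBase {i, j} ↔ (A.H i).direction ≠ (A.H j).direction := by
  refine ⟨fun h hd => ?_, fun h => (A.isBase_iff hr).2 ⟨i, j, rfl, h⟩⟩
  rcases (A.direction_eq_iff i j).1 hd with hb | rfl
  · exact h.1.1 (by rw [inter_pair, hb])
  · obtain ⟨a, b, hS, hab⟩ := (A.isBase_iff hr).1 h
    have := congrArg Finset.card hS
    rw [Finset.card_pair (A.index_ne hab)] at this
    simp at this

/-- A pair of hyperplanes `i < j` which meet, `i` being the least hyperplane through the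
intersection. -/
structure IsNbcPair (A : HArr W n) (i j : Fin n) : Prop where
  lt : i < j
  dir : (A.H i).direction ≠ (A.H j).direction
  min : ∀ k ∈ A.sub (A.H i ⊓ A.H j), i ≤ k

theorem nbcBase_pair_iff (A : HArr W n) (hr : A.rank = 2) {i j : Fin n} (hij : i < j) :
    A.nbcBase 1 {i, j} ↔ A.IsNbcPair i j := by
  constructor
  · rintro ⟨⟨-, hn⟩, hb⟩
    have hd := (A.isBase_pair_iff hr).1 hb
    refine ⟨hij, hd, fun k hk => ?_⟩
    by_contra! hlt
    have hkc : k ∉ ({i, j} : Finset (Fin n)) := by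
      simp only [Finset.mem_insert, Finset.mem_singleton, not_or]
      exact ⟨hlt.ne, (hlt.trans hij).ne⟩
    have hcard : (insert k {i, j} : Finset (Fin n)).card = 3 := by
      rw [Finset.card_insert_of_notMem hkc, Finset.card_pair hij.ne]
    refine hn {i, j} subset_rfl ⟨k, hkc, ?_, ?_, fun T hT hdep => ?_⟩
    · simpa using ⟨hlt, hlt.trans hij⟩
    · have he : A.inter {k, i, j} = A.H i ⊓ A.H j := by
        rw [inter_triple, inf_assoc, inf_eq_right]
        exact A.mem_sub.1 hk
      refine ⟨by rw [he]; exact A.inf_ne_bot hd, ?_⟩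
      rw [he, A.cd_pair hd, hcard]
      omega
    · have h1 := Finset.card_lt_card hT
      have h2 := A.three_le_card_of_dep hdep
      omega
  · rintro ⟨-, hd, hmin⟩
    refine ⟨⟨by rw [inter_pair]; exact A.inf_ne_bot hd, ?_⟩, (A.isBase_pair_iff hr).2 hd⟩
    rintro T hT ⟨k, hk, hlt, hdep, -⟩
    have h1 := A.three_le_card_of_dep hdep
    rw [Finset.card_insert_of_notMem hk] at h1
    have hTe : T = {i, j} := by
      refine Finset.eq_of_subset_of_card_le hT ?_
      rw [Finset.card_pair hij.ne]
      omega
    subst hTe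
    have h2 : A.H i ⊓ A.H j ≤ A.H k := by
      refine A.le_H_of_meet hr hd fun hb => hdep.1 ?_
      rw [inter_triple, inf_assoc, inf_comm, hb]
    have h3 := hlt i (by simp)
    have h4 := hmin k (A.mem_sub.2 h2)
    simp only [Equiv.Perm.coe_one, id_eq] at h3
    exact absurd h3 (not_lt.2 h4)

theorem betaNbcBase_pair_iff (A : HArr W n) (hr : A.rank = 2) {i j : Fin n} (hij : i < j) :
    A.betaNbcBase 1 {i, j} ↔ A.IsNbcPair i j ∧
      (∃ k < i, (A.H k).direction ≠ (A.H j).direction) ∧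
      (∃ k < j, (A.H k).direction ≠ (A.H i).direction) := by
  have h1 : ({i, j} : Finset (Fin n)).erase i = {j} := by
    simp [hij.ne]
  have h2 : ({i, j} : Finset (Fin n)).erase j = {i} := by
    rw [Finset.pair_comm]; simp [hij.ne']
  simp only [betaNbcBase, A.nbcBase_pair_iff hr hij, Finset.forall_mem_insert, h1,
    Finset.mem_singleton, forall_eq, h2, A.isBase_pair_iff hr, Equiv.Perm.coe_one, id_eq]

theorem exists_pair_of_betaNbcBase (A : HArr W n) (hr : A.rank = 2) {S : Finset (Fin n)}
    (h : A.betaNbcBase 1 S) : ∃ i j, S = {i, j} ∧ i < j := by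
  obtain ⟨i, j, rfl, hd⟩ := (A.isBase_iff hr).1 h.1.2
  rcases lt_or_gt_of_ne (A.index_ne hd) with hij | hij
  · exact ⟨i, j, rfl, hij⟩
  · exact ⟨j, i, Finset.pair_comm _ _, hij⟩

end RankTwo

section Weights

variable [FiniteDimensional ℂ W]

theorem denseL_H (A : HArr W n) (i : Fin n) : A.sub (A.H i) = {i} ∧ A.denseL (A.H i) := by
  have hs : A.sub (A.H i) = {i} := by
    ext k
    rw [mem_sub, Finset.mem_singleton]
    exact ⟨fun h => (A.eq_of_H_le h).symm, fun h => by rw [h]⟩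
  refine ⟨hs, ?_⟩
  rintro ⟨S, T, hST, hS, hT, hU, -⟩
  have := congrArg Finset.card hU
  rw [Finset.card_union_of_disjoint hST, hs, Finset.card_singleton] at this
  have := hS.card_pos
  have := hT.card_pos
  omega

theorem lam_ne_zero (A : HArr W n) {lam : Fin n → ℂ}
    (hlam : ∀ X, A.memL X → X ≠ A.amb → A.denseL X → A.lamX lam X ≠ 0) (i : Fin n) :
    lam i ≠ 0 := by
  obtain ⟨hs, hd⟩ := A.denseL_H i
  have := hlam (A.H i) ⟨A.H_ne_bot i, {i}, A.inter_singleton i⟩ ?_ hd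
  · simpa [lamX, hs] using this
  · intro h
    have := A.hyp i
    rw [h] at this
    omega

theorem denseL_of_three_le (A : HArr W n) (hr : A.rank = 2) {i j : Fin n}
    (h : (A.H i).direction ≠ (A.H j).direction)
    (hc : 3 ≤ (A.sub (A.H i ⊓ A.H j)).card) : A.denseL (A.H i ⊓ A.H j) := by
  have key : ∀ S : Finset (Fin n), S ⊆ A.sub (A.H i ⊓ A.H j) → S.Nonempty →
      1 ≤ A.cd (A.inter S) ∧ (2 ≤ S.card → 2 ≤ A.cd (A.inter S)) := by
    rintro S hS ⟨k, hk⟩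
    constructor
    · exact (A.cd_H k).ge.trans (A.cd_anti (A.inter_le_H hk))
    · intro h2
      obtain ⟨a, ha, b, hb, hab⟩ := Finset.one_lt_card.1 h2
      have hd := (A.inf_eq_of_mem_sub hr h (hS ha) (hS hb) hab).1
      exact (A.cd_pair hd).ge.trans (A.cd_anti (le_inf (A.inter_le_H ha) (A.inter_le_H hb)))
  rintro ⟨S, T, hST, hS, hT, hU, hcd⟩
  have h1 := key S (hU ▸ Finset.subset_union_left) hS
  have h2 := key T (hU ▸ Finset.subset_union_right) hT
  rw [← hU, Finset.card_union_of_disjoint hST] at hc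
  rw [A.cd_pair h] at hcd
  omega

theorem lamX_ne_zero_or_sub_eq (A : HArr W n) (hr : A.rank = 2) {lam : Fin n → ℂ}
    (hlam : ∀ X, A.memL X → X ≠ A.amb → A.denseL X → A.lamX lam X ≠ 0) {i j : Fin n}
    (h : (A.H i).direction ≠ (A.H j).direction) :
    A.lamX lam (A.H i ⊓ A.H j) ≠ 0 ∨ A.sub (A.H i ⊓ A.H j) = {i, j} := by
  have hsub : {i, j} ⊆ A.sub (A.H i ⊓ A.H j) := by
    simp [Finset.insert_subset_iff, mem_sub]
  by_cases hc : 3 ≤ (A.sub (A.H i ⊓ A.H j)).card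
  · refine .inl (hlam _ ⟨A.inf_ne_bot h, _, A.inter_pair i j⟩ (fun he => ?_)
      (A.denseL_of_three_le hr h hc))
    have := A.cd_pair h
    rw [he, cd, Nat.sub_self] at this
    omega
  · refine .inr (Finset.eq_of_subset_of_card_le hsub ?_).symm
    rw [Finset.card_pair (A.index_ne h)]
    omega

end Weights

section Algebra

theorem eS_singleton (i : Fin n) : eS {i} = (gen i : ExteriorAlgebra ℂ (Fin n → ℂ)) := by
  simp [eS]

theorem eS_pair {i j : Fin n} (h : i < j) : eS {i, j} = gen i * gen j := by
  rw [eS, Finset.sort_insert _ (by simpa using h.le) (by simpa using h.ne)]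
  simp

theorem pair_eq_pair_iff {i j p k : Fin n} (hij : i < j) (hpk : p < k) :
    ({i, j} : Finset (Fin n)) = {p, k} ↔ i = p ∧ j = k := by
  refine ⟨fun h => ?_, by rintro ⟨rfl, rfl⟩; rfl⟩
  have hi : i ∈ ({p, k} : Finset (Fin n)) := h ▸ by simp
  have hj : j ∈ ({p, k} : Finset (Fin n)) := h ▸ by simp
  simp only [Finset.mem_insert, Finset.mem_singleton] at hi hj
  omega

theorem bdry_triple {i j k : Fin n} (hij : i < j) (hjk : j < k) :
    bdry {i, j, k} = gen j * gen k - gen i * gen k + gen i * gen j := by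
  have hik := hij.trans hjk
  have e1 : ({i, j, k} : Finset (Fin n)).erase i = {j, k} := by grind
  have e2 : ({i, j, k} : Finset (Fin n)).erase j = {i, k} := by grind
  have e3 : ({i, j, k} : Finset (Fin n)).erase k = {i, j} := by grind
  have f1 : ({i, j, k} : Finset (Fin n)).filter (· < i) = ∅ := by grind
  have f2 : ({i, j, k} : Finset (Fin n)).filter (· < j) = {i} := by grind
  have f3 : ({i, j, k} : Finset (Fin n)).filter (· < k) = {i, j} := by grind
  rw [bdry, Finset.sum_insert (by simp [hij.ne, hik.ne]), Finset.sum_pair hjk.ne,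
    e1, e2, e3, f1, f2, f3, eS_pair hjk, eS_pair hik, eS_pair hij, Finset.card_pair hij.ne,
    Finset.card_empty, Finset.card_singleton, pow_zero, pow_one, even_two.neg_one_pow, one_smul,
    neg_one_smul, one_smul]
  abel

/-- The square-zero style operator `(a, w, q) ↦ (0, a v, b v w)`. -/
def shift (b : (Fin n → ℂ) →ₗ[ℂ] (Fin n → ℂ) →ₗ[ℂ] ℂ) :
    (Fin n → ℂ) →ₗ[ℂ] Module.End ℂ (ℂ × (Fin n → ℂ) × ℂ) :=
  LinearMap.mk₂ ℂ (fun v x => (0, x.1 • v, b v x.2.1))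
    (by intros; simp) (fun c v x => by simp [smul_comm x.1 c v]) (by intros; simp [add_smul])
    (by intros; simp [mul_smul])

theorem shift_apply (b : (Fin n → ℂ) →ₗ[ℂ] (Fin n → ℂ) →ₗ[ℂ] ℂ) (v : Fin n → ℂ)
    (x : ℂ × (Fin n → ℂ) × ℂ) : shift b v x = (0, x.1 • v, b v x.2.1) := rfl

/-- The action of the exterior algebra on `ℂ × ℂⁿ × ℂ` through `shift b`. -/
def shiftHom (b : (Fin n → ℂ) →ₗ[ℂ] (Fin n → ℂ) →ₗ[ℂ] ℂ) (hb : ∀ v, b v v = 0) :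
    ExteriorAlgebra ℂ (Fin n → ℂ) →ₐ[ℂ] Module.End ℂ (ℂ × (Fin n → ℂ) × ℂ) :=
  ExteriorAlgebra.lift ℂ ⟨shift b, fun v => by
    ext x <;> simp [shift_apply, hb]⟩

theorem shiftHom_ι (b : (Fin n → ℂ) →ₗ[ℂ] (Fin n → ℂ) →ₗ[ℂ] ℂ) (hb : ∀ v, b v v = 0)
    (v : Fin n → ℂ) : shiftHom b hb (ExteriorAlgebra.ι ℂ v) = shift b v := by
  simp [shiftHom]

theorem shiftHom_mul (b : (Fin n → ℂ) →ₗ[ℂ] (Fin n → ℂ) →ₗ[ℂ] ℂ) (hb : ∀ v, b v v = 0)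
    (u v : Fin n → ℂ) (x : ℂ × (Fin n → ℂ) × ℂ) :
    shiftHom b hb (ExteriorAlgebra.ι ℂ u * ExteriorAlgebra.ι ℂ v) x =
      (0, 0, x.1 * b u v) := by
  rw [map_mul, shiftHom_ι, shiftHom_ι, Module.End.mul_apply, shift_apply, shift_apply]
  simp

theorem shiftHom_eS_of_three_le (b : (Fin n → ℂ) →ₗ[ℂ] (Fin n → ℂ) →ₗ[ℂ] ℂ)
    (hb : ∀ v, b v v = 0) {S : Finset (Fin n)} (hS : 3 ≤ S.card) :
    shiftHom b hb (eS S) = 0 := by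
  rw [← Finset.length_sort (· ≤ ·)] at hS
  rw [eS]
  generalize S.sort (· ≤ ·) = l at hS
  match l, hS with
  | i :: j :: k :: t, _ =>
    ext x <;> simp [gen, shiftHom_ι, shift_apply]

theorem exists_functional (A : HArr W n) [FiniteDimensional ℂ W]
    (b : (Fin n → ℂ) →ₗ[ℂ] (Fin n → ℂ) →ₗ[ℂ] ℂ) (hb : ∀ v, b v v = 0)
    (hbot : ∀ i j, A.H i ⊓ A.H j = ⊥ → b (Pi.single i 1) (Pi.single j 1) = 0)
    (hdep : ∀ i j k, i < j → j < k → A.H i ⊓ A.H j ⊓ A.H k ≠ ⊥ →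
      b (Pi.single j 1) (Pi.single k 1) - b (Pi.single i 1) (Pi.single k 1) +
        b (Pi.single i 1) (Pi.single j 1) = 0) :
    ∃ F : OS A →ₗ[ℂ] ℂ, ∀ u v, F (A.osMk (ExteriorAlgebra.ι ℂ u * ExteriorAlgebra.ι ℂ v)) =
      b u v := by
  have hrel : ∀ ⦃x y⦄, OSRel A x y → shiftHom b hb x = shiftHom b hb y := by
    rintro x y (⟨S, hS⟩ | ⟨S, hS⟩)
    · rw [map_zero]
      rcases (A.two_le_card_of_inter_eq_bot hS).eq_or_lt with h2 | h2
      · obtain ⟨i, j, hij, rfl⟩ := Finset.card_eq_two.1 h2.symm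
        wlog hlt : i < j generalizing i j
        · rw [Finset.pair_comm]
          exact this j i hij.symm (by rwa [Finset.pair_comm]) (by rwa [Finset.pair_comm])
            (lt_of_le_of_ne (not_lt.1 hlt) hij.symm)
        rw [inter_pair] at hS
        rw [eS_pair hlt, gen, gen]
        refine LinearMap.ext fun x => ?_
        rw [shiftHom_mul, hbot i j hS]
        simp
      · exact shiftHom_eS_of_three_le b hb h2
    · rw [map_zero]
      rcases (A.three_le_card_of_dep hS).eq_or_lt with h3 | h3
      · obtain ⟨i, j, k, hij, hjk, rfl⟩ : ∃ i j k, i < j ∧ j < k ∧ S = {i, j, k} := by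
          let f := S.orderEmbOfFin h3.symm
          refine ⟨f 0, f 1, f 2, f.strictMono (by decide), f.strictMono (by decide), ?_⟩
          rw [← Finset.coe_inj, ← S.range_orderEmbOfFin h3.symm]
          ext x
          simp only [Set.mem_range, Fin.exists_fin_succ, f, Finset.coe_insert,
            Finset.coe_singleton, Set.mem_insert_iff, Set.mem_singleton_iff, eq_comm (a := x)]
          simp
        have hne := hS.1
        rw [inter_triple] at hne
        rw [bdry_triple hij hjk]
        refine LinearMap.ext fun x => ?_
        have := hdep i j k hij hjk hne
        simp only [map_add, map_sub, gen, LinearMap.add_apply, LinearMap.sub_apply,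
          shiftHom_mul, Prod.mk_add_mk, Prod.mk_sub_mk, ← mul_sub, ← mul_add, this]
        simp
      · rw [bdry, map_sum]
        refine Finset.sum_eq_zero fun i hi => ?_
        rw [map_smul, shiftHom_eS_of_three_le, smul_zero]
        rw [Finset.card_erase_of_mem hi]
        omega
  let G : OS A →ₐ[ℂ] Module.End ℂ (ℂ × (Fin n → ℂ) × ℂ) :=
    RingQuot.liftAlgHom ℂ ⟨shiftHom b hb, hrel⟩
  refine ⟨LinearMap.snd ℂ _ _ ∘ₗ LinearMap.snd ℂ _ _ ∘ₗ
    LinearMap.applyₗ ((1, 0, 0) : ℂ × (Fin n → ℂ) × ℂ) ∘ₗ G.toLinearMap, fun u v => ?_⟩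
  have hG : G (A.osMk (ExteriorAlgebra.ι ℂ u * ExteriorAlgebra.ι ℂ v)) =
      shiftHom b hb (ExteriorAlgebra.ι ℂ u * ExteriorAlgebra.ι ℂ v) :=
    RingQuot.liftAlgHom_mkAlgHom_apply ℂ _ hrel _
  simp only [LinearMap.comp_apply, AlgHom.toLinearMap_apply, hG, LinearMap.applyₗ_apply_apply,
    shiftHom_mul]
  simp

/-- The residue form at a set `C` of indices, in the direction of `k`:
`(u, v) ↦ (∑_{i ∈ C} u_i) v_k - (∑_{i ∈ C} v_i) u_k`. -/
def resForm (C : Finset (Fin n)) (k : Fin n) :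
    (Fin n → ℂ) →ₗ[ℂ] (Fin n → ℂ) →ₗ[ℂ] ℂ :=
  LinearMap.mk₂ ℂ (fun u v => (∑ i ∈ C, u i) * v k - (∑ i ∈ C, v i) * u k)
    (by intros; simp [Finset.sum_add_distrib]; ring)
    (by intros; simp [← Finset.mul_sum]; ring)
    (by intros; simp [Finset.sum_add_distrib]; ring)
    (by intros; simp [← Finset.mul_sum]; ring)

theorem resForm_apply (C : Finset (Fin n)) (k : Fin n) (u v : Fin n → ℂ) :
    resForm C k u v = (∑ i ∈ C, u i) * v k - (∑ i ∈ C, v i) * u k := rfl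

theorem resForm_single (C : Finset (Fin n)) (k i j : Fin n) :
    resForm C k (Pi.single i 1) (Pi.single j 1) =
      (if i ∈ C then 1 else 0) * (if j = k then 1 else 0) -
        (if j ∈ C then 1 else 0) * (if i = k then 1 else 0) := by
  simp [resForm_apply, Pi.single_apply, eq_comm]

theorem exists_residue (A : HArr W n) [FiniteDimensional ℂ W] (hr : A.rank = 2) {p k : Fin n}
    (h : (A.H p).direction ≠ (A.H k).direction) :
    ∃ F : OS A →ₗ[ℂ] ℂ, ∀ u v, F (A.osMk (ExteriorAlgebra.ι ℂ u * ExteriorAlgebra.ι ℂ v)) =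
      resForm (A.sub (A.H p ⊓ A.H k)) k u v := by
  have hk : k ∈ A.sub (A.H p ⊓ A.H k) := A.mem_sub.2 inf_le_right
  have key : ∀ i ∈ A.sub (A.H p ⊓ A.H k), ∀ j ∈ A.sub (A.H p ⊓ A.H k), i ≠ j →
      ∀ l, A.H i ⊓ A.H j ⊓ A.H l ≠ ⊥ → l ∈ A.sub (A.H p ⊓ A.H k) := by
    intro i hi j hj hij l hl
    obtain ⟨hd, he⟩ := A.inf_eq_of_mem_sub hr h hi hj hij
    rw [mem_sub, ← he]
    exact A.le_H_of_meet hr hd hl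
  refine A.exists_functional _ (fun v => by rw [resForm_apply]; ring) ?_ ?_
  · intro i j hij
    have hn : i ∈ A.sub (A.H p ⊓ A.H k) → j ∈ A.sub (A.H p ⊓ A.H k) → False := by
      intro hi hj
      rw [mem_sub] at hi hj
      exact A.inf_ne_bot h (le_bot_iff.1 (hij ▸ le_inf hi hj))
    rw [resForm_single]
    by_cases hjk : j = k
    · subst hjk
      have : i ∉ A.sub (A.H p ⊓ A.H j) := fun hi => hn hi hk
      have : i ≠ j := fun e => this (e ▸ hk)
      simp [*]
    · by_cases hik : i = k
      · subst hik
        have : j ∉ A.sub (A.H p ⊓ A.H i) := fun hj => hn hk hj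
        simp [*]
      · simp [*]
  · intro i j l hij hjl hne
    have h1 := fun hi hj => key i hi j hj hij.ne l hne
    have h2 := fun hi hl => key i hi l hl (hij.trans hjl).ne j (by rwa [inf_right_comm])
    have h3 := fun hj hl => key j hj l hl hjl.ne i (by rwa [inf_comm, ← inf_assoc])
    simp only [resForm_single]
    by_cases hi : i ∈ A.sub (A.H p ⊓ A.H k) <;> by_cases hj : j ∈ A.sub (A.H p ⊓ A.H k) <;>
      by_cases hl : l ∈ A.sub (A.H p ⊓ A.H k) <;> simp only [hi, hj, hl, if_true, if_false] <;>
      grind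

theorem osMk_ι (A : HArr W n) (v : Fin n → ℂ) :
    A.osMk (ExteriorAlgebra.ι ℂ v) = ∑ i, v i • A.om i := by
  simp only [om, gen, ← map_smul, ← map_sum]
  congr 2
  ext i
  simp [Pi.single_apply]

theorem mem_Ideg_one_iff (A : HArr W n) (lam : Fin n → ℂ) (x : OS A) :
    x ∈ A.Ideg lam 1 ↔
      ∃ v, x = A.osMk (ExteriorAlgebra.ι ℂ lam * ExteriorAlgebra.ι ℂ v) := by
  have hl : A.omLam lam = A.osMk (ExteriorAlgebra.ι ℂ lam) := (A.osMk_ι lam).symm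
  have hd : A.deg 1 = LinearMap.range (A.osMk.toLinearMap ∘ₗ ExteriorAlgebra.ι ℂ) := by
    apply le_antisymm
    · refine Submodule.span_le.2 ?_
      rintro _ ⟨S, hS, rfl⟩
      obtain ⟨i, rfl⟩ := Finset.card_eq_one.1 hS
      exact ⟨Pi.single i 1, by simp [omB, eS_singleton, gen]⟩
    · rintro _ ⟨v, rfl⟩
      rw [LinearMap.comp_apply, AlgHom.toLinearMap_apply, osMk_ι]
      refine Submodule.sum_mem _ fun i _ => Submodule.smul_mem _ _ (Submodule.subset_span ?_)
      exact ⟨{i}, Finset.card_singleton i, by rw [omB, eS_singleton, om]⟩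
  rw [Ideg, hd]
  simp only [Submodule.mem_map, LinearMap.mem_range, exists_exists_eq_and,
    LinearMap.mulLeft_apply, LinearMap.comp_apply, AlgHom.toLinearMap_apply, hl, map_mul,
    eq_comm (a := x)]

theorem omB_pair (A : HArr W n) {i j : Fin n} (h : i < j) :
    A.omB {i, j} = A.om i * A.om j := by
  rw [omB, eS_pair h, map_mul, om, om]

theorem om_mul_self (A : HArr W n) (i : Fin n) : A.om i * A.om i = 0 := by
  rw [om, gen, ← map_mul, ExteriorAlgebra.ι_sq_zero, map_zero]

theorem om_mul_swap (A : HArr W n) (i j : Fin n) : A.om i * A.om j = -(A.om j * A.om i) := by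
  rw [eq_neg_iff_add_eq_zero, om, om, gen, gen, ← map_mul A.osMk, ← map_mul A.osMk,
    ← map_add A.osMk, ExteriorAlgebra.ι_add_mul_swap, map_zero]

theorem om_mul_mem_comm (A : HArr W n) {M : Submodule ℂ (OS A)} {i j : Fin n} :
    A.om i * A.om j ∈ M ↔ A.om j * A.om i ∈ M := by
  rw [om_mul_swap, neg_mem_iff]

theorem omLam_mul_om (A : HArr W n) (lam : Fin n → ℂ) (k : Fin n) :
    A.omLam lam * A.om k = ∑ i, lam i • (A.om i * A.om k) := by
  simp [omLam, Finset.sum_mul]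

theorem om_mul_eq_zero (A : HArr W n) {i j : Fin n} (h : A.H i ⊓ A.H j = ⊥) :
    A.om i * A.om j = 0 := by
  wlog hij : i < j generalizing i j
  · rcases (not_lt.1 hij).eq_or_lt with rfl | hij
    · exact A.om_mul_self _
    · rw [om_mul_swap, this (by rwa [inf_comm]) hij, neg_zero]
  have := RingQuot.mkAlgHom_rel ℂ (OSRel.isBot (A := A) {i, j} (by rwa [inter_pair]))
  rwa [map_zero, eS_pair hij, map_mul] at this

theorem om_mul_of_lt (A : HArr W n) [FiniteDimensional ℂ W] {i j k : Fin n} (hij : i < j)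
    (hjk : j < k) (h : (A.H i).direction ≠ (A.H j).direction)
    (hk : A.H i ⊓ A.H j ≤ A.H k) :
    A.om j * A.om k - A.om i * A.om k + A.om i * A.om j = 0 := by
  have he : A.inter {i, j, k} = A.H i ⊓ A.H j := by
    rw [inter_triple, inf_eq_left.2 hk]
  have hdep : A.dep {i, j, k} := by
    refine ⟨he ▸ A.inf_ne_bot h, ?_⟩
    rw [he, A.cd_pair h, Finset.card_eq_three.2
      ⟨i, j, k, hij.ne, (hij.trans hjk).ne, hjk.ne, rfl⟩]
    omega
  have := RingQuot.mkAlgHom_rel ℂ (OSRel.isDep _ hdep)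
  rw [bdry_triple hij hjk, map_zero, map_add, map_sub, map_mul, map_mul, map_mul] at this
  exact this

theorem om_mul_of_mem_sub (A : HArr W n) [FiniteDimensional ℂ W] (hr : A.rank = 2)
    {p q i j k : Fin n} (h : (A.H p).direction ≠ (A.H q).direction)
    (hi : i ∈ A.sub (A.H p ⊓ A.H q)) (hj : j ∈ A.sub (A.H p ⊓ A.H q))
    (hk : k ∈ A.sub (A.H p ⊓ A.H q)) :
    A.om j * A.om k = A.om i * A.om k - A.om i * A.om j := by
  have key : ∀ a ∈ A.sub (A.H p ⊓ A.H q), ∀ b ∈ A.sub (A.H p ⊓ A.H q),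
      ∀ c ∈ A.sub (A.H p ⊓ A.H q), a < b → b < c →
      A.om b * A.om c - A.om a * A.om c + A.om a * A.om b = 0 := by
    intro a ha b hb c hc hab hbc
    obtain ⟨hd, he⟩ := A.inf_eq_of_mem_sub hr h ha hb hab.ne
    exact A.om_mul_of_lt hab hbc hd (he ▸ A.mem_sub.1 hc)
  have sij := A.om_mul_swap i j
  have sik := A.om_mul_swap i k
  have sjk := A.om_mul_swap j k
  have zi := A.om_mul_self i
  have zj := A.om_mul_self j
  have zk := A.om_mul_self k
  rcases lt_trichotomy i j with hij | rfl | hij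
  · rcases lt_trichotomy j k with hjk | rfl | hjk
    · have := key i hi j hj k hk hij hjk; grind
    · grind
    · rcases lt_trichotomy i k with hik | rfl | hik
      · have := key i hi k hk j hj hik hjk; grind
      · grind
      · have := key k hk i hi j hj hik hij; grind
  · grind
  · rcases lt_trichotomy i k with hik | rfl | hik
    · have := key j hj i hi k hk hij hik; grind
    · grind
    · rcases lt_trichotomy j k with hjk | rfl | hjk
      · have := key j hj k hk i hi hjk hik; grind
      · grind
      · have := key k hk j hj i hi hjk hij; grind

end Algebra

section Admissible

variable [FiniteDimensional ℂ W]

theorem exists_isNbcPair_min (A : HArr W n) (hr : A.rank = 2) {i j : Fin n}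
    (h : (A.H i).direction ≠ (A.H j).direction) :
    ∃ p ∈ A.sub (A.H i ⊓ A.H j), ∀ k ∈ A.sub (A.H i ⊓ A.H j), k ≠ p → A.IsNbcPair p k := by
  have hne : (A.sub (A.H i ⊓ A.H j)).Nonempty := ⟨i, A.mem_sub.2 inf_le_left⟩
  refine ⟨_, Finset.min'_mem _ hne, fun k hk hkp => ?_⟩
  obtain ⟨hd, he⟩ := A.inf_eq_of_mem_sub hr h (Finset.min'_mem _ hne) hk hkp.symm
  refine ⟨lt_of_le_of_ne (Finset.min'_le _ _ hk) hkp.symm, hd, fun l hl => ?_⟩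
  rw [he] at hl
  exact Finset.min'_le _ _ hl

theorem resForm_of_isNbcPair (A : HArr W n) (hr : A.rank = 2) {p k i j : Fin n}
    (hpk : A.IsNbcPair p k) (hij : A.IsNbcPair i j) :
    resForm (A.sub (A.H p ⊓ A.H k)) k (Pi.single i 1) (Pi.single j 1) =
      if i = p ∧ j = k then 1 else 0 := by
  have hp : p ∈ A.sub (A.H p ⊓ A.H k) := A.mem_sub.2 inf_le_left
  have hk : k ∈ A.sub (A.H p ⊓ A.H k) := A.mem_sub.2 inf_le_right
  rw [resForm_single]
  by_cases hik : i = k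
  · subst hik
    have hj : j ∉ A.sub (A.H p ⊓ A.H i) := by
      intro hj
      obtain ⟨-, he⟩ := A.inf_eq_of_mem_sub hr hpk.dir hk hj hij.lt.ne
      exact absurd (hij.min p (he ▸ hp)) (not_le.2 hpk.lt)
    simp [hj, hij.lt.ne', hpk.lt.ne']
  · by_cases hjk : j = k
    · subst hjk
      have hi : i ∈ A.sub (A.H p ⊓ A.H j) ↔ i = p := by
        refine ⟨fun hi => ?_, fun hi => hi ▸ hp⟩
        obtain ⟨-, he⟩ := A.inf_eq_of_mem_sub hr hpk.dir hi hk hik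
        exact le_antisymm (hij.min p (he ▸ hp)) (hpk.min i hi)
      simp [hi, hik]
    · simp [hik, hjk]

theorem exists_threshold (A : HArr W n) (hr : A.rank = 2) (hn : 0 < n) {ν : ℕ}
    (hadm : ∀ i : Fin n,
      (A.H i ⊓ A.H ⟨0, hn⟩ = ⊥ ∨ i = ⟨0, hn⟩) ↔ (i : ℕ) + 1 < ν) :
    ∃ m : Fin n, ∀ i, (A.H i).direction = (A.H ⟨0, hn⟩).direction ↔ i < m := by
  simp only [← direction_eq_iff] at hadm
  obtain ⟨a, b, hab⟩ := A.exists_direction_ne hr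
  obtain ⟨c, hc⟩ : ∃ c, (A.H c).direction ≠ (A.H ⟨0, hn⟩).direction := by
    by_contra! hc
    exact hab ((hc a).trans (hc b).symm)
  have h1 := (not_congr (hadm c)).1 hc
  have h2 := c.2
  refine ⟨⟨ν - 1, by omega⟩, fun i => (hadm i).trans ?_⟩
  rw [Fin.lt_def]
  dsimp only
  omega

variable {z m : Fin n}

theorem isNbcPair_of_direction_eq (A : HArr W n) (hr : A.rank = 2)
    (hm : ∀ i, (A.H i).direction = (A.H z).direction ↔ i < m) {i j : Fin n}
    (hi : (A.H i).direction = (A.H z).direction)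
    (hj : (A.H j).direction ≠ (A.H z).direction) : A.IsNbcPair i j := by
  have hd : (A.H i).direction ≠ (A.H j).direction := fun h => hj (h.symm.trans hi)
  have him := (hm i).1 hi
  refine ⟨him.trans_le (not_lt.1 fun h => hj ((hm j).2 h)), hd, fun l hl => ?_⟩
  by_contra! hlt
  refine (A.inf_eq_of_mem_sub hr hd (A.mem_sub.2 inf_le_left) hl hlt.ne').1 ?_
  rw [hi, (hm l).2 (hlt.trans him)]

theorem betaNbcBase_iff_of_admissible (A : HArr W n) (hr : A.rank = 2) (hz : ∀ i, z ≤ i)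
    (hm : ∀ i, (A.H i).direction = (A.H z).direction ↔ i < m) {i j : Fin n} (hij : i < j) :
    A.betaNbcBase 1 {i, j} ↔ A.IsNbcPair i j ∧ i ≠ z ∧ j ≠ m := by
  rw [A.betaNbcBase_pair_iff hr hij]
  refine and_congr_right fun h => ⟨?_, ?_⟩
  · rintro ⟨⟨k, hki, -⟩, l, hlj, hl⟩
    refine ⟨?_, ?_⟩
    · rintro rfl
      exact absurd hki (not_lt.2 (hz k))
    · rintro rfl
      exact hl (((hm l).2 hlj).trans ((hm i).2 hij).symm)
  · rintro ⟨hiz, hjm⟩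
    have hzi : z < i := lt_of_le_of_ne (hz i) hiz.symm
    refine ⟨⟨z, hzi, fun he => ?_⟩, ?_⟩
    · exact h.dir (((hm i).2 (hij.trans ((hm j).1 he.symm))).trans he)
    · by_cases hd : (A.H i).direction = (A.H z).direction
      · refine ⟨m, ?_, fun he => lt_irrefl m ((hm m).1 (he.trans hd))⟩
        refine lt_of_le_of_ne (not_lt.1 fun hlt => ?_) hjm.symm
        exact h.dir (hd.trans ((hm j).2 hlt).symm)
      · exact ⟨z, hzi.trans hij, Ne.symm hd⟩

theorem eq_zero_of_resForm (A : HArr W n) (hr : A.rank = 2)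
    (hm : ∀ i, (A.H i).direction = (A.H z).direction ↔ i < m) {lam : Fin n → ℂ}
    (hlam : ∀ X, A.memL X → X ≠ A.amb → A.denseL X → A.lamX lam X ≠ 0) {w : Fin n → ℂ}
    (hwz : w z = 0)
    (hres : ∀ p k, A.IsNbcPair p k → (p = z ∨ k = m) →
      resForm (A.sub (A.H p ⊓ A.H k)) k lam w = 0) : w = 0 := by
  have hA : ∀ k, (A.H k).direction ≠ (A.H z).direction → w k = 0 := by
    intro k hk
    have hzP : z ∈ A.sub (A.H z ⊓ A.H k) := A.mem_sub.2 inf_le_left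
    have hkP : k ∈ A.sub (A.H z ⊓ A.H k) := A.mem_sub.2 inf_le_right
    set P := A.sub (A.H z ⊓ A.H k) with hP
    have hrel : ∀ l ∈ P.erase z, (∑ i ∈ P, lam i) * w l = (∑ i ∈ P, w i) * lam l := by
      intro l hl
      obtain ⟨hlz, hl⟩ := Finset.mem_erase.1 hl
      obtain ⟨hd, he⟩ := A.inf_eq_of_mem_sub hr hk.symm hzP hl hlz.symm
      have := hres z l (A.isNbcPair_of_direction_eq hr hm rfl hd.symm) (.inl rfl)
      rw [he, resForm_apply] at this
      exact sub_eq_zero.1 this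
    have hsum := Finset.sum_congr rfl hrel
    rw [← Finset.mul_sum, ← Finset.mul_sum] at hsum
    have h1 := Finset.add_sum_erase P lam hzP
    have h2 := Finset.add_sum_erase P w hzP
    rw [hwz, zero_add] at h2
    rw [h2] at hsum
    have hs : ∑ i ∈ P, w i = 0 := by
      have : (∑ i ∈ P, w i) * lam z = 0 := by linear_combination hsum + (∑ i ∈ P, w i) * h1
      exact (mul_eq_zero.1 this).resolve_right (A.lam_ne_zero hlam z)
    rcases A.lamX_ne_zero_or_sub_eq hr hlam hk.symm with h | h
    · have := hrel k (Finset.mem_erase.2 ⟨fun h => hk (h ▸ rfl), hkP⟩)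
      rw [hs, zero_mul] at this
      exact (mul_eq_zero.1 this).resolve_left h
    · rwa [hP, h, Finset.sum_pair (A.index_ne hk.symm), hwz, zero_add] at hs
  ext k
  by_cases hk : (A.H k).direction = (A.H z).direction
  · have hmz : (A.H m).direction ≠ (A.H z).direction := fun h => lt_irrefl m ((hm m).1 h)
    have hkm := A.isNbcPair_of_direction_eq hr hm hk hmz
    have := hres k m hkm (.inr rfl)
    have hkP : k ∈ A.sub (A.H k ⊓ A.H m) := A.mem_sub.2 inf_le_left
    rw [resForm_apply, hA m hmz, mul_zero, zero_sub, neg_eq_zero,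
      Finset.sum_eq_single_of_mem k hkP fun l hl hlk => hA l fun h =>
        (A.inf_eq_of_mem_sub hr hkm.dir hl hkP hlk).1 (h.trans hk.symm)] at this
    exact (mul_eq_zero.1 this).resolve_right (A.lam_ne_zero hlam m)
  · exact hA k hk

theorem resForm_eq_zero (A : HArr W n) (hr : A.rank = 2)
    (hm : ∀ i, (A.H i).direction = (A.H z).direction ↔ i < m) {lam : Fin n → ℂ}
    (hlam : ∀ X, A.memL X → X ≠ A.amb → A.denseL X → A.lamX lam X ≠ 0) {v : Fin n → ℂ}
    (hres : ∀ p k, A.IsNbcPair p k → (p = z ∨ k = m) →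
      resForm (A.sub (A.H p ⊓ A.H k)) k lam v = 0) (C : Finset (Fin n)) (k : Fin n) :
    resForm C k lam v = 0 := by
  have hinv : ∀ C k, resForm C k lam (v - (v z / lam z) • lam) = resForm C k lam v := by
    intro C k
    rw [map_sub, map_smul, resForm_apply C k lam lam]
    simp
  have h0 : v - (v z / lam z) • lam = 0 := by
    refine A.eq_zero_of_resForm hr hm hlam ?_ fun p k hpk h => (hinv _ _).trans (hres p k hpk h)
    simp [A.lam_ne_zero hlam z]
  rw [← hinv, h0, map_zero]

theorem coeff_eq_zero (A : HArr W n) (hr : A.rank = 2) (hz : ∀ i, z ≤ i)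
    (hm : ∀ i, (A.H i).direction = (A.H z).direction ↔ i < m) {lam : Fin n → ℂ}
    (hlam : ∀ X, A.memL X → X ≠ A.amb → A.denseL X → A.lamX lam X ≠ 0)
    (c : {S : Finset (Fin n) // A.betaNbcBase 1 S} → ℂ)
    (hc : (∑ B, c B • A.omB B.1) ∈ A.Ideg lam 1) : ∀ B, c B = 0 := by
  obtain ⟨v, hv⟩ := (A.mem_Ideg_one_iff lam _).1 hc
  have key : ∀ p k, A.IsNbcPair p k → resForm (A.sub (A.H p ⊓ A.H k)) k lam v =
      ∑ B : {S : Finset (Fin n) // A.betaNbcBase 1 S}, if B.1 = {p, k} then c B else 0 := by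
    intro p k hpk
    obtain ⟨F, hF⟩ := A.exists_residue hr hpk.dir
    rw [← hF, ← hv, map_sum]
    refine Finset.sum_congr rfl fun B _ => ?_
    obtain ⟨S, hB⟩ := B
    obtain ⟨i, j, rfl, hij⟩ := A.exists_pair_of_betaNbcBase hr hB
    have hij' := ((A.betaNbcBase_iff_of_admissible hr hz hm hij).1 hB).1
    rw [map_smul, omB, eS_pair hij, gen, gen, hF, A.resForm_of_isNbcPair hr hpk hij']
    simp [pair_eq_pair_iff hij hpk.lt]
  rintro ⟨S, hB⟩
  obtain ⟨p, k, rfl, hpk⟩ := A.exists_pair_of_betaNbcBase hr hB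
  have hpk' := ((A.betaNbcBase_iff_of_admissible hr hz hm hpk).1 hB).1
  have h := key p k hpk'
  rw [A.resForm_eq_zero hr hm hlam, Finset.sum_eq_single_of_mem ⟨_, hB⟩ (Finset.mem_univ _),
    if_pos rfl] at h
  · exact h.symm
  · intro B _ hne
    exact if_neg fun he => hne (Subtype.ext he)
  · intro a b hab hzm
    rw [key a b hab]
    refine Finset.sum_eq_zero fun B _ => if_neg fun he => ?_
    have := (A.betaNbcBase_iff_of_admissible hr hz hm hab.lt).1 (he ▸ B.2)
    tauto

theorem om_mul_eq_zero_of_direction_eq (A : HArr W n) {i j : Fin n}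
    (h : (A.H i).direction = (A.H j).direction) : A.om i * A.om j = 0 := by
  rcases (A.direction_eq_iff i j).1 h with h | rfl
  · exact A.om_mul_eq_zero h
  · exact A.om_mul_self i

theorem om_mul_mem_of_notMem_sub (A : HArr W n) (hr : A.rank = 2)
    (hm : ∀ i, (A.H i).direction = (A.H z).direction ↔ i < m) {lam : Fin n → ℂ}
    (hm0 : lam m ≠ 0) {M : Submodule ℂ (OS A)}
    (hβ : ∀ i j, A.IsNbcPair i j → i ≠ z → j ≠ m → A.om i * A.om j ∈ M)
    (hI : ∀ k, A.omLam lam * A.om k ∈ M) {i j : Fin n}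
    (hij : z ∉ A.sub (A.H i ⊓ A.H j)) : A.om i * A.om j ∈ M := by
  have hmz : (A.H m).direction ≠ (A.H z).direction := fun h => lt_irrefl m ((hm m).1 h)
  have h1 : ∀ i j, A.IsNbcPair i j → i ≠ z → A.om i * A.om j ∈ M := by
    intro i j hij hiz
    by_cases hjm : j = m
    · subst hjm
      have hd := (hm i).2 hij.lt
      have h := hI i
      rw [omLam_mul_om, ← Finset.add_sum_erase _ _ (Finset.mem_univ j)] at h
      rw [Submodule.add_mem_iff_left, Submodule.smul_mem_iff _ hm0] at h
      · exact A.om_mul_mem_comm.1 h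
      · refine Submodule.sum_mem _ fun l hl => Submodule.smul_mem _ _ ?_
        by_cases hli : (A.H l).direction = (A.H i).direction
        · rw [A.om_mul_eq_zero_of_direction_eq hli]
          exact M.zero_mem
        · exact A.om_mul_mem_comm.1 (hβ i l (A.isNbcPair_of_direction_eq hr hm hd
            fun h => hli (h.trans hd.symm)) hiz (Finset.ne_of_mem_erase hl))
    · exact hβ i j hij hiz hjm
  by_cases hd : (A.H i).direction = (A.H j).direction
  · rw [A.om_mul_eq_zero_of_direction_eq hd]
    exact M.zero_mem
  · obtain ⟨p, hp, hmin⟩ := A.exists_isNbcPair_min hr hd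
    have h2 : ∀ k ∈ A.sub (A.H i ⊓ A.H j), A.om p * A.om k ∈ M := by
      intro k hk
      by_cases hkp : k = p
      · rw [hkp, om_mul_self]
        exact M.zero_mem
      · exact h1 p k (hmin k hk hkp) fun h => hij (h ▸ hp)
    have hi := A.mem_sub.2 (inf_le_left : A.H i ⊓ A.H j ≤ A.H i)
    have hj := A.mem_sub.2 (inf_le_right : A.H i ⊓ A.H j ≤ A.H j)
    rw [A.om_mul_of_mem_sub hr hd hp hi hj]
    exact sub_mem (h2 j hj) (h2 i hi)

theorem om_mul_mem (A : HArr W n) (hr : A.rank = 2)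
    (hm : ∀ i, (A.H i).direction = (A.H z).direction ↔ i < m) {lam : Fin n → ℂ}
    (hlam : ∀ X, A.memL X → X ≠ A.amb → A.denseL X → A.lamX lam X ≠ 0)
    {M : Submodule ℂ (OS A)}
    (hβ : ∀ i j, A.IsNbcPair i j → i ≠ z → j ≠ m → A.om i * A.om j ∈ M)
    (hI : ∀ k, A.omLam lam * A.om k ∈ M) (i j : Fin n) : A.om i * A.om j ∈ M := by
  have h0 : ∀ i j, z ∉ A.sub (A.H i ⊓ A.H j) → A.om i * A.om j ∈ M := fun i j hij =>
    A.om_mul_mem_of_notMem_sub hr hm (A.lam_ne_zero hlam m) hβ hI hij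
  have hA : ∀ k, (A.H k).direction ≠ (A.H z).direction → A.om z * A.om k ∈ M := by
    intro k hk
    have hzP : z ∈ A.sub (A.H z ⊓ A.H k) := A.mem_sub.2 inf_le_left
    have hkP : k ∈ A.sub (A.H z ⊓ A.H k) := A.mem_sub.2 inf_le_right
    set P := A.sub (A.H z ⊓ A.H k) with hP
    set T := ∑ i ∈ P, lam i • (A.om z * A.om i) with hT
    have hrel : ∀ l ∈ P.erase z, (∑ i ∈ P, lam i) • (A.om z * A.om l) - T ∈ M := by
      intro l hl
      obtain ⟨hlz, hl⟩ := Finset.mem_erase.1 hl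
      have h := hI l
      rw [omLam_mul_om, ← Finset.sum_add_sum_compl P, Submodule.add_mem_iff_left] at h
      · rw [hT, Finset.sum_smul, ← Finset.sum_sub_distrib]
        convert h using 2 with i hi
        rw [A.om_mul_of_mem_sub hr hk.symm hzP hi hl, smul_sub]
      · refine Submodule.sum_mem _ fun i hi => Submodule.smul_mem _ _ ?_
        rw [Finset.mem_compl] at hi
        by_cases hd : (A.H i).direction = (A.H l).direction
        · rw [A.om_mul_eq_zero_of_direction_eq hd]
          exact M.zero_mem
        · refine h0 i l fun hzl => hi ?_
          have h1 := (A.inf_eq_of_mem_sub hr hd hzl (A.mem_sub.2 inf_le_right) hlz.symm).2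
          have h2 := (A.inf_eq_of_mem_sub hr hk.symm hzP hl hlz.symm).2
          rw [hP, ← h2, h1]
          exact A.mem_sub.2 inf_le_left
    have hsum := Submodule.sum_mem M fun l hl => M.smul_mem (lam l) (hrel l hl)
    have h1 := Finset.add_sum_erase P lam hzP
    have h2 := Finset.add_sum_erase P (fun i => lam i • (A.om z * A.om i)) hzP
    simp only [om_mul_self, smul_zero, zero_add] at h2
    have hTM : T ∈ M := by
      simp only [smul_sub, Finset.sum_sub_distrib, ← Finset.sum_smul,
        smul_comm (lam _) (∑ i ∈ P, lam i), ← Finset.smul_sum] at hsum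
      rw [h2, ← hT, ← sub_smul, ← h1, add_sub_cancel_right,
        Submodule.smul_mem_iff _ (A.lam_ne_zero hlam z)] at hsum
      exact hsum
    rcases A.lamX_ne_zero_or_sub_eq hr hlam hk.symm with h | h
    · have := add_mem (hrel k (Finset.mem_erase.2 ⟨fun h => hk (h ▸ rfl), hkP⟩)) hTM
      rw [sub_add_cancel] at this
      exact (Submodule.smul_mem_iff _ h).1 this
    · rw [hT, hP, h, Finset.sum_pair (A.index_ne hk.symm), om_mul_self, smul_zero, zero_add]
        at hTM
      exact (Submodule.smul_mem_iff _ (A.lam_ne_zero hlam k)).1 hTM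
  have hA' : ∀ k, A.om z * A.om k ∈ M := by
    intro k
    by_cases hk : (A.H k).direction = (A.H z).direction
    · rw [A.om_mul_eq_zero_of_direction_eq hk.symm]
      exact M.zero_mem
    · exact hA k hk
  by_cases hd : (A.H i).direction = (A.H j).direction
  · rw [A.om_mul_eq_zero_of_direction_eq hd]
    exact M.zero_mem
  · by_cases hzP : z ∈ A.sub (A.H i ⊓ A.H j)
    · rw [A.om_mul_of_mem_sub hr hd hzP (A.mem_sub.2 inf_le_left) (A.mem_sub.2 inf_le_right)]
      exact sub_mem (hA' j) (hA' i)
    · exact h0 i j hzP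

end Admissible

end HArr

/-- If `𝒜` has rank 2, the linear order on `𝒜` is admissible, and
`λ(X) ≠ 0` for every dense `X ∈ L ∖ {V}`, then the residue classes
`{[ω_B] : B ∈ βnbc(𝒜)}` form a ℂ-basis of `A^2/(ω_λ ∧ A^1)`. -/
theorem rank_two_admissible_monomial_basis {W : Type} [AddCommGroup W] [Module ℂ W]
    [FiniteDimensional ℂ W] {n : ℕ} (A : HArr W n) (hn : 0 < n)
    (hr : A.rank = 2) (ν : ℕ)
    (hadm : ∀ i : Fin n,
      (A.H i ⊓ A.H ⟨0, hn⟩ = ⊥ ∨ i = ⟨0, hn⟩) ↔ (i : ℕ) + 1 < ν)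
    (lam : Fin n → ℂ)
    (hlam : ∀ X, A.memL X → X ≠ A.amb → A.denseL X → A.lamX lam X ≠ 0) :
    (∀ c : {S : Finset (Fin n) // A.betaNbcBase 1 S} → ℂ,
      (∑ B, c B • A.omB B.1) ∈ A.Ideg lam 1 → ∀ B, c B = 0) ∧
    A.deg 2 ≤
      Submodule.span ℂ
        (Set.range fun B : {S : Finset (Fin n) // A.betaNbcBase 1 S} => A.omB B.1) ⊔
      A.Ideg lam 1 := by
  obtain ⟨m, hm⟩ := A.exists_threshold hr hn hadm
  have hz : ∀ i : Fin n, (⟨0, hn⟩ : Fin n) ≤ i := fun i => Nat.zero_le _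
  refine ⟨A.coeff_eq_zero hr hz hm hlam, Submodule.span_le.2 ?_⟩
  rintro _ ⟨S, hS, rfl⟩
  obtain ⟨i, j, hij, rfl⟩ : ∃ i j, i < j ∧ S = {i, j} := by
    obtain ⟨i, j, hij, rfl⟩ := Finset.card_eq_two.1 hS
    rcases lt_or_gt_of_ne hij with h | h
    · exact ⟨i, j, h, rfl⟩
    · exact ⟨j, i, h, Finset.pair_comm _ _⟩
  rw [A.omB_pair hij]
  refine A.om_mul_mem hr hm hlam (fun p k hpk hp hk => ?_) (fun k => ?_) i j
  · refine Submodule.mem_sup_left (Submodule.subset_span ⟨⟨{p, k}, ?_⟩, A.omB_pair hpk.lt⟩)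
    exact (A.betaNbcBase_iff_of_admissible hr hz hm hpk.lt).2 ⟨hpk, hp, hk⟩
  · refine Submodule.mem_sup_right (Submodule.mem_map.2 ⟨A.om k, Submodule.subset_span ?_, rfl⟩)
    exact ⟨{k}, Finset.card_singleton k, by rw [HArr.omB, HArr.eS_singleton, HArr.om]⟩
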